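/- arXiv:2305.01261 — 6 statements merged into one kernel-verified Lean document; each statement's English description precedes it below -/
import Mathlib

section
/- For a (v,b,r,λ,ε)-RPBD mechanism Q, the canonical estimator \hat P_{n,x}(Y_1,…,Y_n) = (1/((r−λ)(e^ε−1)))·(N_x(Y_1,…,Y_n)/(nα) − (λe^ε + (r−λ))) is unbiased: for every P ∈ Δ_v and every x ∈ {1,…,v}, E[\hat P_{n,x}(Y_1,…,Y_n)] = P_x, where X_1,…,X_n are i.i.d. P and Y_i ~ Q(·|X_i). -/
open Finset Real
open scoped Classical

noncomputable section

/-- The "row" of an incidence structure: outputs incident to input `x`. -/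
def Ix {v : ℕ} {Y : Type*} [Fintype Y] [DecidableEq Y]
    (I : Finset (Fin v × Y)) (x : Fin v) : Finset Y :=
  Finset.univ.filter (fun y => (x, y) ∈ I)

/-- The "column" of an incidence structure: inputs incident to output `y`. -/
def Iy {v : ℕ} {Y : Type*} [Fintype Y] [DecidableEq Y]
    (I : Finset (Fin v × Y)) (y : Y) : Finset (Fin v) :=
  Finset.univ.filter (fun x => (x, y) ∈ I)

/-- A `(v,b,r,lam)`-regular pairwise-balanced design (RPBD). -/
def IsRPBD {v : ℕ} {Y : Type*} [Fintype Y] [DecidableEq Y]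
    (I : Finset (Fin v × Y)) (b r lam : ℕ) : Prop :=
  0 < v ∧ Fintype.card Y = b ∧ lam < r ∧ r < b ∧
    (∀ x : Fin v, (Ix I x).card = r) ∧
    (∀ x x' : Fin v, x ≠ x' → (Ix I x ∩ Ix I x').card = lam)

/-- A `(v,b,r,k,lam)`-block design: an RPBD that is moreover `k`-uniform, with `0 < k < v`. -/
def IsBlockDesign {v : ℕ} {Y : Type*} [Fintype Y] [DecidableEq Y]
    (I : Finset (Fin v × Y)) (b r k lam : ℕ) : Prop :=
  IsRPBD I b r lam ∧ 0 < k ∧ k < v ∧ ∀ y : Y, (Iy I y).card = k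

/-- The (block design / RPBD) privacy mechanism: output `y` has probability `α e^ε` if
`(x,y) ∈ I` and `α` otherwise, where `α = 1/(r e^ε + b - r)`. -/
def mechQ {v : ℕ} {Y : Type*} [Fintype Y] [DecidableEq Y]
    (I : Finset (Fin v × Y)) (b r : ℕ) (ε : ℝ) (x : Fin v) (y : Y) : ℝ :=
  if (x, y) ∈ I then Real.exp ε / ((r : ℝ) * Real.exp ε + (b : ℝ) - (r : ℝ))
  else 1 / ((r : ℝ) * Real.exp ε + (b : ℝ) - (r : ℝ))

/-- The probability simplex `Δ_v` on `{1,…,v}`. -/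
def simplex (v : ℕ) : Set (Fin v → ℝ) :=
  {P | (∀ x, 0 ≤ P x) ∧ ∑ x, P x = 1}

/-- Marginal distribution of a single privatized output `Y` when `X ~ P`, `Y ~ Q(·|X)`. -/
def outDist {v : ℕ} {Y : Type*} [Fintype Y] (P : Fin v → ℝ) (Q : Fin v → Y → ℝ) (y : Y) : ℝ :=
  ∑ x, P x * Q x y

/-- Joint probability of the i.i.d. outputs `(Y_1,…,Y_n)`. -/
def jointW {v n : ℕ} {Y : Type*} [Fintype Y] (P : Fin v → ℝ) (Q : Fin v → Y → ℝ)
    (ys : Fin n → Y) : ℝ :=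
  ∏ i, outDist P Q (ys i)

/-- The count `N_x(Y_1,…,Y_n) = Σ_i 1(Y_i ∈ ℐ_x)`. -/
def Nx {v n : ℕ} {Y : Type*} [Fintype Y] [DecidableEq Y]
    (I : Finset (Fin v × Y)) (x : Fin v) (ys : Fin n → Y) : ℕ :=
  (Finset.univ.filter (fun i => ys i ∈ Ix I x)).card

/-- The canonical (unbiased) estimator of an RPBD scheme. -/
def canonEst {v n : ℕ} {Y : Type*} [Fintype Y] [DecidableEq Y]
    (I : Finset (Fin v × Y)) (b r lam : ℕ) (ε : ℝ) (x : Fin v) (ys : Fin n → Y) : ℝ :=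
  (1 / (((r : ℝ) - (lam : ℝ)) * (Real.exp ε - 1))) *
    ((Nx I x ys : ℝ) * ((r : ℝ) * Real.exp ε + (b : ℝ) - (r : ℝ)) / (n : ℝ)
      - ((lam : ℝ) * Real.exp ε + ((r : ℝ) - (lam : ℝ))))

/-- The squared `ℓ_2` loss. -/
def l2loss (v : ℕ) (p phat : Fin v → ℝ) : ℝ := ∑ x, (p x - phat x) ^ 2

/-- The risk `R_{v,n}(ℓ, P, Q, P̂_n) = E[ℓ(P, P̂_n(Y_1,…,Y_n))]`. -/
def risk {v : ℕ} {Y : Type*} [Fintype Y] (n : ℕ) (P : Fin v → ℝ) (Q : Fin v → Y → ℝ)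
    (L : (Fin v → ℝ) → (Fin v → ℝ) → ℝ) (est : Fin v → (Fin n → Y) → ℝ) : ℝ :=
  ∑ ys : Fin n → Y, jointW P Q ys * L P (fun x => est x ys)

/-- Marginal equivalence of two schemes: for every `P ∈ Δ_v` and coordinate `x`, the
estimators `P̂_{n,x}` and `P̂'_{n,x}` have the same distribution. -/
def MargEquiv {v : ℕ} {Y Y' : Type*} [Fintype Y] [Fintype Y'] (n : ℕ)
    (Q : Fin v → Y → ℝ) (est : Fin v → (Fin n → Y) → ℝ)
    (Q' : Fin v → Y' → ℝ) (est' : Fin v → (Fin n → Y') → ℝ) : Prop :=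
  ∀ P ∈ simplex v, ∀ x : Fin v, ∀ t : ℝ,
    (∑ ys : Fin n → Y, if est x ys = t then jointW P Q ys else 0)
      = ∑ ys : Fin n → Y', if est' x ys = t then jointW P Q' ys else 0

/-- The expectation of a one-coordinate statistic under a product of weights of total mass one. -/
theorem sum_prod_mul_apply_eq {n : ℕ} {Y : Type*} [Fintype Y] (w f : Y → ℝ)
    (hw : ∑ y, w y = 1) (i : Fin n) :
    ∑ ys : Fin n → Y, (∏ j, w (ys j)) * f (ys i) = ∑ y, w y * f y := by
  have hprod : ∀ ys : Fin n → Y, (∏ j, w (ys j)) * f (ys i)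
      = ∏ j, w (ys j) * (if j = i then f (ys j) else 1) := by
    intro ys
    rw [Finset.prod_mul_distrib, Finset.prod_ite_eq' Finset.univ i (fun j => f (ys j))]
    simp
  calc ∑ ys : Fin n → Y, (∏ j, w (ys j)) * f (ys i)
      = ∑ ys : Fin n → Y, ∏ j, w (ys j) * (if j = i then f (ys j) else 1) :=
        Finset.sum_congr rfl fun ys _ => hprod ys
    _ = ∏ j : Fin n, ∑ y, w y * (if j = i then f y else 1) :=
        (Fintype.prod_sum fun (j : Fin n) (y : Y) => w y * (if j = i then f y else 1)).symm
    _ = ∏ j : Fin n, if j = i then ∑ y, w y * f y else 1 := by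
        refine Finset.prod_congr rfl fun j _ => ?_
        split_ifs <;> simp [hw]
    _ = ∑ y, w y * f y := by simp

/-- A product of weights of total mass one has total mass one. -/
theorem sum_prod_eq_one {n : ℕ} {Y : Type*} [Fintype Y] (w : Y → ℝ) (hw : ∑ y, w y = 1) :
    ∑ ys : Fin n → Y, ∏ j, w (ys j) = 1 := by
  rw [← Fintype.prod_sum fun (_ : Fin n) (y : Y) => w y]
  simp [hw]

/-- The mass the mechanism gives to a set of outputs, up to the normalizing constant. -/
theorem sum_mechQ {v : ℕ} {Y : Type*} [Fintype Y] [DecidableEq Y]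
    (I : Finset (Fin v × Y)) (b r : ℕ) (ε : ℝ) (x : Fin v) (s : Finset Y) :
    ∑ y ∈ s, mechQ I b r ε x y
      = (((Ix I x ∩ s).card : ℝ) * (Real.exp ε - 1) + s.card) /
        ((r : ℝ) * Real.exp ε + (b : ℝ) - (r : ℝ)) := by
  have hpt : ∀ y, mechQ I b r ε x y = ((if y ∈ Ix I x then Real.exp ε - 1 else 0) + 1) /
      ((r : ℝ) * Real.exp ε + (b : ℝ) - (r : ℝ)) := by
    intro y
    by_cases hy : (x, y) ∈ I <;> simp [mechQ, Ix, hy]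
  simp_rw [hpt]
  rw [← Finset.sum_div, Finset.sum_add_distrib, ← Finset.sum_filter, Finset.filter_mem_eq_inter,
    Finset.inter_comm]
  simp [mul_sub]

/-- Averaging the mass of a set of outputs over the input distribution. -/
theorem sum_outDist {v : ℕ} {Y : Type*} [Fintype Y] (P : Fin v → ℝ) (Q : Fin v → Y → ℝ)
    (s : Finset Y) : ∑ y ∈ s, outDist P Q y = ∑ x, P x * ∑ y ∈ s, Q x y := by
  simp_rw [outDist, Finset.mul_sum]
  exact Finset.sum_comm

/-- The canonical estimator of a `(v,b,r,lam,ε)`-RPBD mechanism is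
unbiased: for every `P ∈ Δ_v` and every coordinate `x`,
`E[P̂_{n,x}(Y_1,…,Y_n)] = P_x`. -/
theorem rpbd_canonical_estimator_unbiased {v n b r lam : ℕ} (hn : 0 < n) {Y : Type*}
    [Fintype Y] [DecidableEq Y] (I : Finset (Fin v × Y))
    (h : IsRPBD I b r lam) (ε : ℝ) (hε : 0 < ε)
    (P : Fin v → ℝ) (hP : P ∈ simplex v) (x : Fin v) :
    ∑ ys : Fin n → Y, jointW P (mechQ I b r ε) ys * canonEst I b r lam ε x ys = P x := by
  obtain ⟨-, hb, hlr, hrb, hreg, hbal⟩ := h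
  obtain ⟨-, hP1⟩ := hP
  have hn' : (n : ℝ) ≠ 0 := by positivity
  have hlr' : (r : ℝ) - lam ≠ 0 := sub_ne_zero.2 (by exact_mod_cast hlr.ne')
  have hexp : Real.exp ε - 1 ≠ 0 := sub_ne_zero.2 (Real.one_lt_exp_iff.2 hε).ne'
  have hrb' : (r : ℝ) < b := by exact_mod_cast hrb
  have hD : (r : ℝ) * Real.exp ε + b - r ≠ 0 := by
    have : 0 ≤ (r : ℝ) * Real.exp ε := by positivity
    linarith
  set D : ℝ := (r : ℝ) * Real.exp ε + b - r with hDdef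
  set w : Y → ℝ := outDist P (mechQ I b r ε) with hwdef
  have hw : ∑ y, w y = 1 := by
    rw [hwdef, sum_outDist]
    simp_rw [sum_mechQ, Finset.inter_univ, hreg, Finset.card_univ, hb]
    rw [← Finset.sum_mul, hP1, one_mul, ← hDdef, div_eq_one_iff_eq hD, hDdef]
    ring
  have hmass : ∑ y ∈ Ix I x, w y
      = (P x * ((r : ℝ) - lam) * (Real.exp ε - 1) + lam * (Real.exp ε - 1) + r) / D := by
    have hcard : ∀ x', ((Ix I x' ∩ Ix I x).card : ℝ)
        = (if x' = x then (r : ℝ) - lam else 0) + lam := by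
      intro x'
      split_ifs with hx
      · rw [hx, Finset.inter_self, hreg]
        ring
      · rw [hbal x' x hx, zero_add]
    have hterm : ∀ x', P x' * ((((Ix I x' ∩ Ix I x).card : ℝ) * (Real.exp ε - 1) + r) / D)
        = (if x' = x then P x' * ((r : ℝ) - lam) * (Real.exp ε - 1) / D else 0)
          + P x' * ((lam * (Real.exp ε - 1) + r) / D) := by
      intro x'
      rw [hcard]
      split_ifs <;> ring
    rw [hwdef, sum_outDist]
    simp_rw [sum_mechQ, hreg x, ← hDdef, hterm]
    rw [Finset.sum_add_distrib, ← Finset.sum_mul, hP1, Finset.sum_ite_eq' Finset.univ x]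
    simp only [Finset.mem_univ, if_true]
    ring
  have hcount : ∑ ys : Fin n → Y, jointW P (mechQ I b r ε) ys * (Nx I x ys : ℝ)
      = n * ∑ y ∈ Ix I x, w y := by
    have hN : ∀ ys : Fin n → Y, (Nx I x ys : ℝ) = ∑ i, if ys i ∈ Ix I x then (1 : ℝ) else 0 := by
      intro ys
      simp [Nx]
    simp_rw [hN, Finset.mul_sum]
    rw [Finset.sum_comm]
    have hi : ∀ i : Fin n, ∑ ys : Fin n → Y, jointW P (mechQ I b r ε) ys *
        (if ys i ∈ Ix I x then (1 : ℝ) else 0) = ∑ y ∈ Ix I x, w y := by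
      intro i
      refine (sum_prod_mul_apply_eq w (fun y => if y ∈ Ix I x then (1 : ℝ) else 0) hw i).trans ?_
      simp
    simp_rw [hi]
    simp [Finset.mul_sum]
  have hone : ∑ ys : Fin n → Y, jointW P (mechQ I b r ε) ys = 1 := sum_prod_eq_one w hw
  have hlin : ∀ ys : Fin n → Y, jointW P (mechQ I b r ε) ys * canonEst I b r lam ε x ys
      = 1 / (((r : ℝ) - lam) * (Real.exp ε - 1)) *
        (jointW P (mechQ I b r ε) ys * (Nx I x ys : ℝ) * (D / n)
          - jointW P (mechQ I b r ε) ys * (lam * Real.exp ε + ((r : ℝ) - lam))) := by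
    intro ys
    rw [canonEst]
    ring
  simp_rw [hlin]
  rw [← Finset.mul_sum, Finset.sum_sub_distrib, ← Finset.sum_mul, ← Finset.sum_mul, hcount, hone,
    hmass]
  field_simp
  ring

end
end

section
/- Let (𝒳, 𝒴, ℐ) be a (v,b,r,λ)-RPBD and suppose there exists an integer k ≥ 2 such that r·v = b·k and λ·v·(v−1) = b·k·(k−1) (equivalently, [b : r : λ] = [(v/k)·((v−1)/(k−1)) : (v−1)/(k−1) : 1]). Then ℐ is k-uniform, i.e. |ℐ^y| = k for every y ∈ 𝒴, and hence ℐ is a (v,b,r,k,λ)-block design. -/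
open Finset Real
open scoped Classical

noncomputable section

/-- Double counting of incidences. -/
lemma sum_card_Iy {v : ℕ} {Y : Type*} [Fintype Y] [DecidableEq Y]
    (I : Finset (Fin v × Y)) :
    ∑ y, (Iy I y).card = ∑ x, (Ix I x).card := by
  simp only [Iy, Ix, Finset.card_filter]
  exact Finset.sum_comm

/-- Double counting of pairs of inputs incident to a common output. -/
lemma sum_card_Iy_sq {v : ℕ} {Y : Type*} [Fintype Y] [DecidableEq Y]
    (I : Finset (Fin v × Y)) :
    ∑ y, (Iy I y).card ^ 2 = ∑ x, ∑ x', (Ix I x ∩ Ix I x').card := by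
  simp only [Iy, Ix, ← Finset.filter_and, Finset.card_filter, sq, Finset.sum_mul_sum]
  rw [Finset.sum_comm]
  refine Finset.sum_congr rfl fun x _ => ?_
  rw [Finset.sum_comm]
  refine Finset.sum_congr rfl fun x' _ => Finset.sum_congr rfl fun y _ => ?_
  by_cases hx : (x, y) ∈ I <;> by_cases hx' : (x', y) ∈ I <;> simp [hx, hx']

lemma IsRPBD.sum_card_Iy_sq {v b r lam : ℕ} {Y : Type*} [Fintype Y] [DecidableEq Y]
    {I : Finset (Fin v × Y)} (h : IsRPBD I b r lam) :
    ∑ y, (Iy I y).card ^ 2 = r * v + lam * v * (v - 1) := by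
  obtain ⟨-, -, -, -, hr, hlam⟩ := h
  rw [_root_.sum_card_Iy_sq]
  have hrow (x : Fin v) : ∑ x', (Ix I x ∩ Ix I x').card = r + (v - 1) * lam := by
    rw [← Finset.add_sum_erase _ _ (Finset.mem_univ x), Finset.inter_self, hr,
      Finset.sum_congr rfl fun x' hx' => hlam x x' (Finset.ne_of_mem_erase hx').symm]
    simp
  simp only [hrow, Finset.sum_const, Finset.card_univ, Fintype.card_fin, smul_eq_mul]
  ring

/-- If a `(v,b,r,lam)`-RPBD satisfies `r·v = b·k` and
`lam·v·(v−1) = b·k·(k−1)` for some integer `k ≥ 2` (i.e. the ratio `[b : r : lam]` equals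
`[(v/k)((v−1)/(k−1)) : (v−1)/(k−1) : 1]`), then it is `k`-uniform, hence a
`(v,b,r,k,lam)`-block design. -/
theorem rpbd_ss_ratio_implies_block_design {v b r lam k : ℕ} {Y : Type*}
    [Fintype Y] [DecidableEq Y] (I : Finset (Fin v × Y))
    (h : IsRPBD I b r lam) (hk : 2 ≤ k)
    (h1 : r * v = b * k) (h2 : lam * v * (v - 1) = b * (k * (k - 1))) :
    (∀ y : Y, (Iy I y).card = k) ∧ IsBlockDesign I b r k lam := by
  have hunif : ∀ y : Y, (Iy I y).card = k := by
    have hsum : ∑ y, (Iy I y).card = b * k := by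
      rw [sum_card_Iy, Finset.sum_congr rfl fun x _ => h.2.2.2.2.1 x, ← h1]
      simp [mul_comm]
    have hsq : ∑ y, (Iy I y).card ^ 2 = b * k ^ 2 := by
      obtain ⟨m, rfl⟩ : ∃ m, k = m + 1 := ⟨k - 1, by omega⟩
      rw [h.sum_card_Iy_sq, h1, h2, Nat.add_sub_cancel]
      ring
    have hvar : ∑ y, (((Iy I y).card : ℤ) - k) ^ 2 = 0 := by
      zify at hsum hsq
      simp only [sub_sq, Finset.sum_add_distrib, Finset.sum_sub_distrib, ← Finset.sum_mul,
        ← Finset.mul_sum, hsum, hsq, Finset.sum_const, Finset.card_univ, h.2.1, nsmul_eq_mul]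
      ring
    intro y
    have hy := (Finset.sum_eq_zero_iff_of_nonneg fun y _ => sq_nonneg _).1 hvar y
      (Finset.mem_univ y)
    exact_mod_cast sub_eq_zero.1 (pow_eq_zero_iff two_ne_zero |>.1 hy)
  refine ⟨hunif, h, by omega, ?_, hunif⟩
  obtain ⟨hv, -, -, hrb, -, -⟩ := h
  by_contra! hvk
  have : r * v < b * k := Nat.mul_lt_mul_of_lt_of_le hrb hvk (by omega)
  omega

end
end

section
/- Let 𝒳 = {1,…,v}, let 𝒴 be a finite set, let Q be any conditional distribution from 𝒳 to 𝒴, and let n ≥ 1. If there exists an estimator \hat P_n : 𝒴^n → ℝ^v such that the scheme (Q, \hat P_n) is unbiased, then |𝒴| ≥ v. -/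
open Finset Real
open scoped Classical

noncomputable section

/-- In a simplex of positive size, the uniform distribution can be moved a little in any
direction with zero sum. -/
theorem exists_uniform_add_mem_simplex {v : ℕ} (hv : 0 < v) (c : Fin v → ℝ)
    (hc : ∑ x, c x = 0) :
    ∃ t : ℝ, 0 < t ∧ (fun x => (v : ℝ)⁻¹ + t * c x) ∈ simplex v := by
  have hv' : (0 : ℝ) < v := by exact_mod_cast hv
  have hS : 0 ≤ ∑ x, |c x| := Finset.sum_nonneg fun x _ => abs_nonneg _
  refine ⟨(v : ℝ)⁻¹ * (1 + ∑ x, |c x|)⁻¹, by positivity, fun x => ?_, ?_⟩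
  · have hle : |c x| ≤ ∑ x, |c x| :=
      Finset.single_le_sum (f := fun x => |c x|) (fun x _ => abs_nonneg _) (Finset.mem_univ x)
    have hneg : -(1 + ∑ x, |c x|) ≤ c x := by linarith [neg_abs_le (c x)]
    have hfac : (v : ℝ)⁻¹ + (v : ℝ)⁻¹ * (1 + ∑ x, |c x|)⁻¹ * c x
        = (v : ℝ)⁻¹ * (1 + ∑ x, |c x|)⁻¹ * ((1 + ∑ x, |c x|) + c x) := by
      field_simp
    change 0 ≤ (v : ℝ)⁻¹ + (v : ℝ)⁻¹ * (1 + ∑ x, |c x|)⁻¹ * c x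
    rw [hfac]
    exact mul_nonneg (by positivity) (by linarith)
  · rw [Finset.sum_add_distrib, ← Finset.mul_sum, hc]
    simp [hv'.ne']

/-- The rows of the conditional distribution of an unbiased scheme are linearly independent. -/
theorem linearIndependent_of_unbiased {v n : ℕ} {Y : Type*} [Fintype Y]
    (Q : Fin v → Y → ℝ) (hQ : ∀ x, ∑ y, Q x y = 1)
    (est : Fin v → (Fin n → Y) → ℝ)
    (hunb : ∀ P ∈ simplex v, ∀ x : Fin v,
      ∑ ys : Fin n → Y, jointW P Q ys * est x ys = P x) :
    LinearIndependent ℝ Q := by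
  rw [Fintype.linearIndependent_iff]
  intro c hc x
  have hcy : ∀ y, ∑ x, c x * Q x y = 0 := fun y => by simpa using congrFun hc y
  have hc0 : ∑ x, c x = 0 := by
    calc ∑ x, c x = ∑ x, ∑ y, c x * Q x y := by simp [← Finset.mul_sum, hQ]
      _ = ∑ y, ∑ x, c x * Q x y := Finset.sum_comm
      _ = 0 := by simp [hcy]
  obtain ⟨t, ht, hmem⟩ := exists_uniform_add_mem_simplex x.pos c hc0
  obtain ⟨_, _, hmem₀⟩ := exists_uniform_add_mem_simplex x.pos 0 (by simp)
  simp only [Pi.zero_apply, mul_zero, add_zero] at hmem₀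
  have hout : outDist (fun x => (v : ℝ)⁻¹ + t * c x) Q
      = outDist (fun _ => (v : ℝ)⁻¹) Q := by
    funext y
    simp only [outDist, add_mul, Finset.sum_add_distrib, mul_assoc, ← Finset.mul_sum, hcy,
      mul_zero, add_zero]
  have h₁ := hunb _ hmem x
  have h₀ := hunb _ hmem₀ x
  simp only [jointW, hout] at h₁ h₀
  have htc : t * c x = 0 := by linarith
  exact (mul_eq_zero.mp htc).resolve_left ht.ne'

/-- If a scheme `(Q, P̂_n)` with input alphabet `{1,…,v}`, finite output
alphabet `Y` and `n ≥ 1` clients is unbiased, then `|Y| ≥ v`. -/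
theorem unbiased_scheme_output_size {v n : ℕ} (hn : 0 < n) {Y : Type*} [Fintype Y]
    (Q : Fin v → Y → ℝ) (hQ : ∀ x, (∀ y, 0 ≤ Q x y) ∧ ∑ y, Q x y = 1)
    (est : Fin v → (Fin n → Y) → ℝ)
    (hunb : ∀ P ∈ simplex v, ∀ x : Fin v,
      ∑ ys : Fin n → Y, jointW P Q ys * est x ys = P x) :
    v ≤ Fintype.card Y := by
  simpa using
    (linearIndependent_of_unbiased Q (fun x => (hQ x).2) est hunb).fintype_card_le_finrank

end
end

section
/- For integers v ≥ 2, k ∈ {1,…,v−1} and ε > 0: k ∈ K_opt(v,ε) holds if and only if E(k, k+1; v) ≤ e^ε ≤ E(k−1, k; v) (with E(0,1;v) := ∞). Moreover, if e^ε = E(k, k+1; v) for some k, then K_opt(v,ε) = {k, k+1}; otherwise K_opt(v,ε) is a singleton. -/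
open Finset Real

noncomputable section

/-- `L(v,k,ε) = (k e^ε + v - k)² / (k (v-k))`. -/
def Lfun (v k : ℕ) (ε : ℝ) : ℝ :=
  ((k : ℝ) * Real.exp ε + (v : ℝ) - (k : ℝ)) ^ 2 / ((k : ℝ) * ((v : ℝ) - (k : ℝ)))

/-- `K_opt(v,ε)`: the set of `k ∈ {1,…,v-1}` minimizing `L(v,k,ε)`. -/
def Kopt (v : ℕ) (ε : ℝ) : Set ℕ :=
  {k | k ∈ Finset.Icc 1 (v - 1) ∧ ∀ k' ∈ Finset.Icc 1 (v - 1), Lfun v k ε ≤ Lfun v k' ε}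

/-- `E(k₁,k₂;v) = √((v-k₁)(v-k₂)/(k₁k₂))`. -/
def Efun (k₁ k₂ v : ℕ) : ℝ :=
  Real.sqrt (((v : ℝ) - (k₁ : ℝ)) * ((v : ℝ) - (k₂ : ℝ)) / ((k₁ : ℝ) * (k₂ : ℝ)))

theorem exists_Lfun_sub_Lfun_eq {v a b : ℕ} (ε : ℝ) (ha : 1 ≤ a) (hab : a < b) (hb : b < v) :
    ∃ c : ℝ, 0 < c ∧ Lfun v b ε - Lfun v a ε =
      c * (Real.exp ε ^ 2 - ((v : ℝ) - a) * ((v : ℝ) - b) / ((a : ℝ) * b)) := by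
  have ha' : (0 : ℝ) < a := by exact_mod_cast ha
  have hab' : (a : ℝ) < b := by exact_mod_cast hab
  have hb' : (b : ℝ) < v := by exact_mod_cast hb
  have hb₀ : (0 : ℝ) < b := ha'.trans hab'
  have hva : (0 : ℝ) < v - a := by linarith
  have hvb : (0 : ℝ) < v - b := by linarith
  refine ⟨v * (b - a) / ((v - a) * (v - b)),
    div_pos (mul_pos (by linarith) (by linarith)) (by positivity), ?_⟩
  unfold Lfun
  field_simp
  ring

theorem Efun_le_exp_iff {v a b : ℕ} (ε : ℝ) (ha : 1 ≤ a) (hab : a < b) (hb : b < v) :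
    Efun a b v ≤ Real.exp ε ↔ Lfun v a ε ≤ Lfun v b ε := by
  obtain ⟨c, hc, h⟩ := exists_Lfun_sub_Lfun_eq ε ha hab hb
  rw [Efun, Real.sqrt_le_left (Real.exp_pos ε).le, ← sub_nonneg,
    ← sub_nonneg (b := Lfun v a ε), h, mul_nonneg_iff_of_pos_left hc]

theorem exp_le_Efun_iff {v a b : ℕ} (ε : ℝ) (ha : 1 ≤ a) (hab : a < b) (hb : b < v) :
    Real.exp ε ≤ Efun a b v ↔ Lfun v b ε ≤ Lfun v a ε := by
  obtain ⟨c, hc, h⟩ := exists_Lfun_sub_Lfun_eq ε ha hab hb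
  rw [Efun, Real.le_sqrt' (Real.exp_pos ε), ← sub_nonpos,
    ← sub_nonpos (a := Lfun v b ε), h, ← neg_nonneg (a := c * _), ← mul_neg,
    mul_nonneg_iff_of_pos_left hc, neg_nonneg]

theorem Efun_anti {v a a' b b' : ℕ} (ha : 1 ≤ a) (haa : a ≤ a') (hb : 1 ≤ b) (hbb : b ≤ b')
    (hav : a' ≤ v) (hbv : b' ≤ v) : Efun a' b' v ≤ Efun a b v := by
  have ha₀ : (0 : ℝ) < a := by exact_mod_cast ha
  have hb₀ : (0 : ℝ) < b := by exact_mod_cast hb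
  have haa₀ : (a : ℝ) ≤ a' := by exact_mod_cast haa
  have hbb₀ : (b : ℝ) ≤ b' := by exact_mod_cast hbb
  have hav₀ : (0 : ℝ) ≤ v - a' := sub_nonneg.2 (by exact_mod_cast hav)
  have hbv₀ : (0 : ℝ) ≤ v - b' := sub_nonneg.2 (by exact_mod_cast hbv)
  have hav₁ : (0 : ℝ) ≤ v - a := by linarith
  have hbv₁ : (0 : ℝ) ≤ v - b := by linarith
  unfold Efun
  gcongr

theorem Efun_strictAnti {v a a' b b' : ℕ} (ha : 1 ≤ a) (haa : a < a') (hb : 1 ≤ b) (hbb : b < b')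
    (hav : a' ≤ v) (hbv : b' ≤ v) : Efun a' b' v < Efun a b v := by
  have ha₀ : (0 : ℝ) < a := by exact_mod_cast ha
  have hb₀ : (0 : ℝ) < b := by exact_mod_cast hb
  have haa₀ : (a : ℝ) < a' := by exact_mod_cast haa
  have hbb₀ : (b : ℝ) < b' := by exact_mod_cast hbb
  have hav₀ : (0 : ℝ) ≤ v - a' := sub_nonneg.2 (by exact_mod_cast hav)
  have hbv₀ : (0 : ℝ) ≤ v - b' := sub_nonneg.2 (by exact_mod_cast hbv)
  have hnum : ((v : ℝ) - a') * (v - b') < (v - a) * (v - b) :=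
    mul_lt_mul'' (by linarith) (by linarith) hav₀ hbv₀
  unfold Efun
  refine Real.sqrt_lt_sqrt (by positivity) (div_lt_div₀ hnum (by gcongr) ?_ (by positivity))
  exact mul_nonneg (by linarith) (by linarith)

theorem Efun_succ_lt_iff {v a b : ℕ} (ha : 1 ≤ a) (hb : 1 ≤ b) (hav : a < v) (hbv : b < v) :
    Efun a (a + 1) v < Efun b (b + 1) v ↔ b < a := by
  refine ⟨fun h => ?_, fun h => Efun_strictAnti hb h (by lia) (by lia) (by lia) (by lia)⟩
  by_contra! hba
  exact absurd h (Efun_anti ha hba (by lia) (by lia) (by lia) (by lia)).not_gt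

theorem Efun_self_right (v k : ℕ) : Efun k v v = 0 := by simp [Efun]

theorem mem_Kopt_iff {v k : ℕ} (ε : ℝ) (hk : 1 ≤ k) (hkv : k < v) :
    k ∈ Kopt v ε ↔
      Efun k (k + 1) v ≤ Real.exp ε ∧ (k = 1 ∨ Real.exp ε ≤ Efun (k - 1) k v) := by
  constructor
  · rintro ⟨-, h⟩
    refine ⟨?_, or_iff_not_imp_left.2 fun hk1 => ?_⟩
    · rcases eq_or_lt_of_le (Nat.succ_le_of_lt hkv) with hv | hv
      · rw [← Nat.succ_eq_add_one, hv, Efun_self_right]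
        exact (Real.exp_pos ε).le
      · exact (Efun_le_exp_iff ε hk k.lt_succ_self hv).2
          (h _ (Finset.mem_Icc.2 ⟨by lia, by lia⟩))
    · exact (exp_le_Efun_iff ε (by lia) (by lia) hkv).2
        (h _ (Finset.mem_Icc.2 ⟨by lia, by lia⟩))
  · rintro ⟨h₁, h₂⟩
    refine ⟨Finset.mem_Icc.2 ⟨hk, by lia⟩, fun j hj => ?_⟩
    obtain ⟨hj₁, hjv⟩ := Finset.mem_Icc.1 hj
    rcases lt_trichotomy j k with hjk | rfl | hjk
    · refine (exp_le_Efun_iff ε hj₁ hjk hkv).1 ((h₂.resolve_left (by lia)).trans ?_)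
      exact Efun_anti hj₁ (by lia) hk le_rfl (by lia) hkv.le
    · exact le_rfl
    · refine (Efun_le_exp_iff ε hk hjk (by lia)).1 (le_trans ?_ h₁)
      exact Efun_anti hk le_rfl (by lia) hjk hkv.le (by lia)

theorem Kopt_nonempty {v : ℕ} (hv : 2 ≤ v) (ε : ℝ) : (Kopt v ε).Nonempty :=
  Finset.exists_min_image (Finset.Icc 1 (v - 1)) (fun k => Lfun v k ε)
    (Finset.nonempty_Icc.2 (by lia))

theorem exp_eq_Efun_of_mem_Kopt {v a b : ℕ} {ε : ℝ} (ha : a ∈ Kopt v ε) (hb : b ∈ Kopt v ε)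
    (hab : a < b) : Real.exp ε = Efun a (a + 1) v := by
  obtain ⟨ha₁, -⟩ := Finset.mem_Icc.1 ha.1
  obtain ⟨-, hbv⟩ := Finset.mem_Icc.1 hb.1
  have h₁ := ((mem_Kopt_iff ε ha₁ (by lia)).1 ha).1
  have h₂ := ((mem_Kopt_iff ε (by lia) (by lia)).1 hb).2.resolve_left (by lia)
  exact le_antisymm (h₂.trans (Efun_anti ha₁ (by lia) (by lia) hab (by lia) (by lia))) h₁

/-- For `k ∈ {1,…,v−1}`: `k ∈ K_opt(v,ε)` iff
`E(k,k+1;v) ≤ e^ε ≤ E(k−1,k;v)` (the upper constraint being vacuous when `k = 1`, i.e.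
`E(0,1;v) = ∞`). Moreover, if `e^ε = E(k,k+1;v)` for some `k`, then
`K_opt(v,ε) = {k, k+1}`; otherwise `K_opt(v,ε)` is a singleton. -/
theorem Kopt_characterization (v : ℕ) (hv : 2 ≤ v) (ε : ℝ) (hε : 0 < ε) :
    (∀ k ∈ Finset.Icc 1 (v - 1),
      (k ∈ Kopt v ε ↔
        Efun k (k + 1) v ≤ Real.exp ε ∧ (k = 1 ∨ Real.exp ε ≤ Efun (k - 1) k v)))
    ∧ (∀ k ∈ Finset.Icc 1 (v - 2),
        Real.exp ε = Efun k (k + 1) v → Kopt v ε = {k, k + 1})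
    ∧ ((∀ k ∈ Finset.Icc 1 (v - 2), Real.exp ε ≠ Efun k (k + 1) v) →
        ∃ k : ℕ, Kopt v ε = {k}) := by
  refine ⟨fun k hk => ?_, fun k hk hE => ?_, fun hE => ?_⟩
  · obtain ⟨hk₁, hkv⟩ := Finset.mem_Icc.1 hk
    exact mem_Kopt_iff ε hk₁ (by lia)
  · obtain ⟨hk₁, hkv⟩ := Finset.mem_Icc.1 hk
    ext j
    simp only [Set.mem_insert_iff, Set.mem_singleton_iff]
    constructor
    · intro hj
      obtain ⟨hj₁, hjv⟩ := Finset.mem_Icc.1 hj.1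
      obtain ⟨h₁, h₂⟩ := (mem_Kopt_iff ε hj₁ (by lia)).1 hj
      rw [hE, ← not_lt, Efun_succ_lt_iff hk₁ hj₁ (by lia) (by lia)] at h₁
      rcases h₂ with rfl | h₂
      · lia
      · obtain ⟨i, rfl⟩ := Nat.exists_eq_add_of_le' hj₁
        rcases Nat.eq_zero_or_pos i with rfl | hi
        · lia
        · rw [Nat.add_sub_cancel, hE, ← not_lt,
            Efun_succ_lt_iff hi hk₁ (by lia) (by lia)] at h₂
          lia
    · rintro (rfl | rfl)
      · refine (mem_Kopt_iff ε hk₁ (by lia)).2 ⟨hE.ge, or_iff_not_imp_left.2 fun hj => ?_⟩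
        rw [hE]
        exact Efun_anti (by lia) (by lia) hk₁ (by lia) (by lia) (by lia)
      · refine (mem_Kopt_iff ε (by lia) (by lia)).2 ⟨?_, Or.inr hE.le⟩
        rw [hE]
        exact Efun_anti hk₁ (by lia) (by lia) (by lia) (by lia) (by lia)
  · obtain ⟨k, hk⟩ := Kopt_nonempty hv ε
    refine ⟨k, Set.eq_singleton_iff_unique_mem.2 ⟨hk, fun j hj => ?_⟩⟩
    obtain ⟨hk₁, hkv⟩ := Finset.mem_Icc.1 hk.1
    obtain ⟨hj₁, hjv⟩ := Finset.mem_Icc.1 hj.1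
    rcases lt_trichotomy j k with hjk | hjk | hjk
    · exact absurd (exp_eq_Efun_of_mem_Kopt hj hk hjk)
        (hE j (Finset.mem_Icc.2 ⟨hj₁, by lia⟩))
    · exact hjk
    · exact absurd (exp_eq_Efun_of_mem_Kopt hk hj hjk)
        (hE k (Finset.mem_Icc.2 ⟨hk₁, by lia⟩))

end
end

section
/- Let v ≥ 2 be an integer, ε > 0, and let L(v,k,ε) = (ke^ε + v − k)²/(k(v−k)) for k ∈ {1,…,v−1}. For all integers 1 ≤ k₁ < k₂ ≤ v−1, the inequality L(v,k₁,ε) ≤ L(v,k₂,ε) holds if and only if e^ε ≥ E(k₁,k₂;v). -/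
open Finset Real

noncomputable section

/-- For integers `1 ≤ k₁ < k₂ ≤ v−1`,
`L(v,k₁,ε) ≤ L(v,k₂,ε)` iff `e^ε ≥ E(k₁,k₂;v)`. -/
theorem Lfun_le_iff_exp_ge_Efun (v : ℕ) (hv : 2 ≤ v) (ε : ℝ) (hε : 0 < ε)
    (k₁ k₂ : ℕ) (hk₁ : 1 ≤ k₁) (h₁₂ : k₁ < k₂) (hk₂ : k₂ ≤ v - 1) :
    Lfun v k₁ ε ≤ Lfun v k₂ ε ↔ Efun k₁ k₂ v ≤ Real.exp ε := by
  have ha : (0 : ℝ) < k₁ := by exact_mod_cast hk₁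
  have hb : (0 : ℝ) < k₂ := by exact_mod_cast hk₁.trans h₁₂.le
  have hab : (0 : ℝ) < k₂ - k₁ := sub_pos.2 (by exact_mod_cast h₁₂)
  have hbv : (0 : ℝ) < v - k₂ := sub_pos.2 (by exact_mod_cast (by lia : k₂ < v))
  have hav : (0 : ℝ) < v - k₁ := by linarith
  have hv₀ : (0 : ℝ) < v := by linarith
  have key : Lfun v k₂ ε - Lfun v k₁ ε =
      v * (k₂ - k₁) / ((v - k₁) * (v - k₂)) *
        (Real.exp ε ^ 2 - ((v : ℝ) - k₁) * (v - k₂) / (k₁ * k₂)) := by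
    unfold Lfun
    field_simp
    ring
  rw [← sub_nonneg, key, mul_nonneg_iff_of_pos_left (by positivity), sub_nonneg, Efun,
    Real.sqrt_le_left (Real.exp_pos ε).le]

end
end

section
/- Let v ≥ 5 be an odd integer, ε > 0, and k = (v−1)/2. Then k ∈ K_opt(v,ε) if and only if ε ≤ (1/2)·log( (v+1)(v+3) / ((v−1)(v−3)) ). -/
open Finset Real

noncomputable section

lemma Lfun_sub_Lfun {v k j : ℕ} (ε : ℝ) (hk : 0 < k) (hkv : k < v) (hj : 0 < j) (hjv : j < v) :
    Lfun v j ε - Lfun v k ε =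
      (v : ℝ) / ((k : ℝ) * j * (v - k) * (v - j)) *
        (((k : ℝ) - j) * (((v : ℝ) - k) * (v - j) - k * j * Real.exp ε ^ 2)) := by
  have hk' : (k : ℝ) ≠ 0 := by positivity
  have hj' : (j : ℝ) ≠ 0 := by positivity
  have hkv' : (v : ℝ) - k ≠ 0 := (sub_pos.2 (Nat.cast_lt.2 hkv)).ne'
  have hjv' : (v : ℝ) - j ≠ 0 := (sub_pos.2 (Nat.cast_lt.2 hjv)).ne'
  unfold Lfun
  field_simp
  ring

lemma Lfun_le_Lfun_iff {v k j : ℕ} (ε : ℝ) (hk : 0 < k) (hkv : k < v) (hj : 0 < j)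
    (hjv : j < v) :
    Lfun v k ε ≤ Lfun v j ε ↔
      0 ≤ ((k : ℝ) - j) * (((v : ℝ) - k) * (v - j) - k * j * Real.exp ε ^ 2) := by
  have hkv' : (0 : ℝ) < (v : ℝ) - k := sub_pos.2 (Nat.cast_lt.2 hkv)
  have hjv' : (0 : ℝ) < (v : ℝ) - j := sub_pos.2 (Nat.cast_lt.2 hjv)
  have hv : 0 < v := hk.trans hkv
  rw [← sub_nonneg, Lfun_sub_Lfun ε hk hkv hj hjv, mul_nonneg_iff_of_pos_left (by positivity)]

lemma le_half_log_iff {ε y : ℝ} (hy : 0 < y) :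
    ε ≤ 1 / 2 * Real.log y ↔ Real.exp ε ^ 2 ≤ y := by
  rw [← Real.exp_nat_mul, ← Real.le_log_iff_exp_le hy]
  push_cast
  constructor <;> intro h <;> linarith

/-- For odd `v ≥ 5` and `k = (v−1)/2`:
`k ∈ K_opt(v,ε)` iff `ε ≤ (1/2)·log((v+1)(v+3)/((v−1)(v−3)))`. -/
theorem Kopt_odd_half (v : ℕ) (hv : 5 ≤ v) (hodd : Odd v) (ε : ℝ) (hε : 0 < ε) :
    (v - 1) / 2 ∈ Kopt v ε ↔
      ε ≤ (1 / 2) * Real.log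
        (((v : ℝ) + 1) * ((v : ℝ) + 3) / (((v : ℝ) - 1) * ((v : ℝ) - 3))) := by
  obtain ⟨m, rfl⟩ := hodd
  have hm : 2 ≤ m := by omega
  have hmR : (2 : ℝ) ≤ m := by exact_mod_cast hm
  have hhalf : (2 * m + 1 - 1) / 2 = m := by omega
  have hx : 1 ≤ Real.exp ε ^ 2 := one_le_pow₀ (Real.one_le_exp hε.le)
  have hden : (0 : ℝ) < m * (m - 1) := mul_pos (by linarith) (by linarith)
  have hratio : (((2 * m + 1 : ℕ) : ℝ) + 1) * (((2 * m + 1 : ℕ) : ℝ) + 3) /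
      ((((2 * m + 1 : ℕ) : ℝ) - 1) * (((2 * m + 1 : ℕ) : ℝ) - 3)) =
      ((m : ℝ) + 1) * (m + 2) / (m * (m - 1)) := by
    push_cast
    rw [div_eq_div_iff (by nlinarith) hden.ne']
    ring
  rw [hhalf, hratio, le_half_log_iff (by positivity), le_div_iff₀ hden]
  constructor
  · rintro ⟨-, h⟩
    have h1 := h (m - 1) (Finset.mem_Icc.2 ⟨by omega, by omega⟩)
    rw [Lfun_le_Lfun_iff ε (by omega) (by omega) (by omega) (by omega)] at h1
    push_cast [Nat.cast_sub (show 1 ≤ m by omega)] at h1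
    linarith
  · intro h
    refine ⟨Finset.mem_Icc.2 ⟨by omega, by omega⟩, fun j hj => ?_⟩
    obtain ⟨hj1, hj2⟩ := Finset.mem_Icc.1 hj
    rw [Lfun_le_Lfun_iff ε (by omega) (by omega) (by omega) (by omega)]
    have hj0 : (1 : ℝ) ≤ j := by exact_mod_cast hj1
    push_cast
    rcases lt_trichotomy j m with hlt | rfl | hgt
    · have hjm : (j : ℝ) + 1 ≤ m := by exact_mod_cast hlt
      refine mul_nonneg (by linarith) ?_
      have hle : (m : ℝ) * j * Real.exp ε ^ 2 ≤ m * (m - 1) * Real.exp ε ^ 2 := by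
        gcongr
        linarith
      nlinarith
    · simp
    · have hjm : (m : ℝ) + 1 ≤ j := by exact_mod_cast hgt
      refine mul_nonneg_of_nonpos_of_nonpos (by linarith) ?_
      have hle : (m : ℝ) * j * 1 ≤ m * j * Real.exp ε ^ 2 := by gcongr
      nlinarith

end
end
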